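/- For every Ω > 0, ∫_{-∞}^{∞} sech²(z/2) tanh(z/2) sin(Ωz) dz = 4πΩ²/sinh(Ωπ). -/

import Mathlib

open MeasureTheory Real

lemma beta_sigmoid {u v : ℂ} (hu : 0 < u.re) (hv : 0 < v.re) :
    Integrable (fun z : ℝ => |sigmoid z * (1 - sigmoid z)| •
      (((sigmoid z : ℝ) : ℂ) ^ (u - 1) * (1 - ((sigmoid z : ℝ) : ℂ)) ^ (v - 1))) ∧
    ∫ z : ℝ, |sigmoid z * (1 - sigmoid z)| •
      (((sigmoid z : ℝ) : ℂ) ^ (u - 1) * (1 - ((sigmoid z : ℝ) : ℂ)) ^ (v - 1))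
      = Complex.betaIntegral u v := by
  have hd : ∀ x ∈ (Set.univ : Set ℝ), HasDerivWithinAt sigmoid
      ((fun x => sigmoid x * (1 - sigmoid x)) x) Set.univ x :=
    fun x _ => (hasDerivAt_sigmoid x).hasDerivWithinAt
  have hc := Complex.betaIntegral_convergent hu hv
  rw [intervalIntegrable_iff_integrableOn_Ioo_of_le zero_le_one] at hc
  have h1 := integrableOn_image_iff_integrableOn_abs_deriv_smul MeasurableSet.univ hd
    sigmoid_injective.injOn
    (fun x : ℝ => (x : ℂ) ^ (u - 1) * (1 - (x : ℂ)) ^ (v - 1))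
  have h2 := integral_image_eq_integral_abs_deriv_smul MeasurableSet.univ hd
    sigmoid_injective.injOn
    (fun x : ℝ => (x : ℂ) ^ (u - 1) * (1 - (x : ℂ)) ^ (v - 1))
  rw [Set.image_univ, range_sigmoid] at h1 h2
  refine ⟨integrableOn_univ.1 (h1.1 hc), ?_⟩
  rw [setIntegral_univ] at h2
  rw [← h2, Complex.betaIntegral, intervalIntegral.integral_of_le zero_le_one,
    integral_Ioc_eq_integral_Ioo]

lemma cpow_sigmoid (z : ℝ) (w : ℂ) :
    ((sigmoid z : ℝ) : ℂ) ^ w * (1 - ((sigmoid z : ℝ) : ℂ)) ^ (-w) = Complex.exp (w * z) := by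
  have h0 := sigmoid_pos z
  have h1 : 0 < 1 - sigmoid z := by linarith [sigmoid_lt_one z]
  have hl : Real.log (sigmoid z) - Real.log (1 - sigmoid z) = z := by
    rw [← sigmoid_neg, ← sigmoid_mul_rexp_neg, Real.log_mul h0.ne' (exp_pos _).ne', Real.log_exp]
    ring
  have e : (1 - ((sigmoid z : ℝ) : ℂ)) = ((1 - sigmoid z : ℝ) : ℂ) := by push_cast; rfl
  rw [e, Complex.cpow_def_of_ne_zero (by exact_mod_cast h0.ne'),
    Complex.cpow_def_of_ne_zero (by exact_mod_cast h1.ne'), ← Complex.exp_add,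
    ← Complex.ofReal_log h0.le, ← Complex.ofReal_log h1.le]
  congr 1
  nth_rw 3 [← hl]
  push_cast
  ring

lemma sech_tanh_sigmoid (z : ℝ) :
    (1/Real.cosh (z/2))^2 * Real.tanh (z/2)
      = 4 * (sigmoid z * (1 - sigmoid z)) * (sigmoid z - (1 - sigmoid z)) := by
  rw [← sigmoid_neg, Real.tanh_eq_sinh_div_cosh, Real.cosh_eq, Real.sinh_eq, sigmoid_def,
    sigmoid_def]
  have e1 : exp (-z) = exp (-(z/2)) ^ 2 := by rw [← Real.exp_nat_mul]; congr 1; push_cast; ring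
  have e2 : exp (- -z) = (exp (-(z/2)))⁻¹ ^ 2 := by
    rw [← Real.exp_neg, ← Real.exp_nat_mul]; congr 1; push_cast; ring
  have e3 : exp (z/2) = (exp (-(z/2)))⁻¹ := by rw [← Real.exp_neg]; congr 1; ring
  rw [e1, e2, e3]
  have := exp_pos (-(z/2))
  generalize exp (-(z/2)) = t at *
  field_simp
  ring

theorem integral_sech2_tanh_sin (Ω : ℝ) (hΩ : 0 < Ω) :
    ∫ z : ℝ, (1/Real.cosh (z/2))^2 * Real.tanh (z/2) * Real.sin (Ω * z)
      = 4 * π * Ω^2 / Real.sinh (Ω * π) := by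
  set w : ℂ := Ω * Complex.I with hw
  have hw0 : w ≠ 0 := by simp [hw, hΩ.ne']
  have r1 : 0 < (2 + w).re := by simp [hw]
  have r2 : 0 < (1 - w).re := by simp [hw]
  have r3 : 0 < (1 + w).re := by simp [hw]
  have r4 : 0 < (2 - w).re := by simp [hw]
  obtain ⟨i1, j1⟩ := beta_sigmoid r1 r2
  obtain ⟨i2, j2⟩ := beta_sigmoid r3 r4
  have hpt : ∀ z : ℝ, (1/Real.cosh (z/2))^2 * Real.tanh (z/2) * Real.sin (Ω * z)
      = 4 * RCLike.im ((|sigmoid z * (1 - sigmoid z)| •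
      (((sigmoid z : ℝ) : ℂ) ^ (2 + w - 1) * (1 - ((sigmoid z : ℝ) : ℂ)) ^ (1 - w - 1))) -
      (|sigmoid z * (1 - sigmoid z)| •
      (((sigmoid z : ℝ) : ℂ) ^ (1 + w - 1) * (1 - ((sigmoid z : ℝ) : ℂ)) ^ (2 - w - 1)))) := by
    intro z
    have h0 := sigmoid_pos z
    have h1 : 0 < 1 - sigmoid z := by linarith [sigmoid_lt_one z]
    have h0c : ((sigmoid z : ℝ) : ℂ) ≠ 0 := by exact_mod_cast h0.ne'
    have h1c : (1 - ((sigmoid z : ℝ) : ℂ)) ≠ 0 := by exact_mod_cast h1.ne'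
    have e := cpow_sigmoid z w
    rw [abs_of_pos (mul_pos h0 h1), sech_tanh_sigmoid,
      show 2 + w - 1 = w + 1 by ring, show 1 - w - 1 = -w by ring, show 1 + w - 1 = w by ring,
      show 2 - w - 1 = -w + 1 by ring, Complex.cpow_add _ _ h0c, Complex.cpow_add _ _ h1c,
      Complex.cpow_one, Complex.cpow_one]
    have e' : (sigmoid z * (1 - sigmoid z)) • (((sigmoid z : ℝ) : ℂ) ^ w * sigmoid z *
        (1 - ((sigmoid z : ℝ) : ℂ)) ^ (-w)) - (sigmoid z * (1 - sigmoid z)) •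
        (((sigmoid z : ℝ) : ℂ) ^ w * ((1 - ((sigmoid z : ℝ) : ℂ)) ^ (-w) * (1 - sigmoid z)))
        = (((sigmoid z * (1 - sigmoid z)) * (sigmoid z - (1 - sigmoid z)) : ℝ) : ℂ) *
          Complex.exp ((Ω * z : ℝ) * Complex.I) := by
      rw [show ((Ω * z : ℝ) : ℂ) * Complex.I = w * z by rw [hw]; push_cast; ring, ← e,
        Complex.real_smul, Complex.real_smul]
      push_cast
      ring
    rw [e', RCLike.im_eq_complex_im, Complex.im_ofReal_mul, Complex.exp_ofReal_mul_I_im]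
    ring
  simp_rw [hpt]
  have him := integral_im (i1.sub i2)
  simp only [Pi.sub_apply] at him
  rw [integral_const_mul, him, integral_sub i1 i2, j1, j2]
  have b1 := Complex.Gamma_mul_Gamma_eq_betaIntegral r1 r2
  have b2 := Complex.Gamma_mul_Gamma_eq_betaIntegral r3 r4
  have g3 : Complex.Gamma 3 = 2 := by
    rw [show (3 : ℂ) = ((2 : ℕ) : ℂ) + 1 by norm_num, Complex.Gamma_nat_eq_factorial 2]
    norm_num
  rw [show 2 + w + (1 - w) = 3 by ring, g3, show 2 + w = (1 + w) + 1 by ring,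
    Complex.Gamma_add_one _ (by intro h; simp [h] at r3), show 1 + w = w + 1 by ring,
    Complex.Gamma_add_one _ hw0] at b1
  rw [show 1 + w + (2 - w) = 3 by ring, g3, show 2 - w = (1 - w) + 1 by ring,
    Complex.Gamma_add_one _ (by intro h; simp [h] at r2), show 1 + w = w + 1 by ring,
    Complex.Gamma_add_one _ hw0] at b2
  have g := Complex.Gamma_mul_Gamma_one_sub w
  rw [show (π : ℂ) * w = ((Ω * π : ℝ) : ℂ) * Complex.I by rw [hw]; push_cast; ring,
    Complex.sin_mul_I, ← Complex.ofReal_sinh] at g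
  have hs : 0 < Real.sinh (Ω * π) := Real.sinh_pos_iff.2 (by positivity)
  have hsc : ((Real.sinh (Ω * π) : ℝ) : ℂ) ≠ 0 := by exact_mod_cast hs.ne'
  have key : Complex.betaIntegral (2 + w) (1 - w) - Complex.betaIntegral (1 + w) (2 - w)
      = ((π * Ω^2 / Real.sinh (Ω * π) : ℝ) : ℂ) * Complex.I := by
    rw [show 2 + w = w + 1 + 1 by ring, show 1 + w = w + 1 by ring,
      show 2 - w = 1 - w + 1 by ring]
    have : Complex.betaIntegral (w + 1 + 1) (1 - w) - Complex.betaIntegral (w + 1) (1 - w + 1)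
        = w ^ 2 * (Complex.Gamma w * Complex.Gamma (1 - w)) := by
      linear_combination (-b1 + b2) / 2
    rw [this, g, hw]
    push_cast at hsc ⊢
    have hI := Complex.I_ne_zero
    field_simp
  rw [key, RCLike.im_eq_complex_im, Complex.im_ofReal_mul, Complex.I_im]
  ring
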